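/- Let F : Rel → Rel be a locally continuous functor which is strict (it maps set inclusions to set inclusions, i.e. E ⊆ E' implies F(E) ⊆ F(E') and F sends the inclusion relation to the inclusion relation). Then for any directed family 𝒟 of sets, F(⋃𝒟) = ⋃_{E∈𝒟} F(E). -/

import Mathlib

/-- Relational composition (diagrammatic order). -/
def relComp {U : Type*} (r s : Set (U × U)) : Set (U × U) :=
  {p | ∃ b, (p.1, b) ∈ r ∧ (b, p.2) ∈ s}

/-- The diagonal (identity/inclusion) relation on a set `E`. -/
def diagRel {U : Type*} (E : Set U) : Set (U × U) :=
  {p | p.1 = p.2 ∧ p.1 ∈ E}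

/-- A functor on the category `Rel` of sets (subsets of a universe `U`)
and relations. -/
structure RelFunctor (U : Type*) where
  obj : Set U → Set U
  map : (E F : Set U) → Set (U × U) → Set (U × U)
  map_sub : ∀ E F r, r ⊆ E ×ˢ F → map E F r ⊆ obj E ×ˢ obj F
  map_id : ∀ E, map E E (diagRel E) = diagRel (obj E)
  map_comp : ∀ E F G r s, r ⊆ E ×ˢ F → s ⊆ F ×ˢ G →
    map E G (relComp r s) = relComp (map E F r) (map F G s)

/-- Local continuity: commutation with directed unions of morphisms. -/
def LocallyContinuous {U : Type*} (F : RelFunctor U) : Prop :=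
  ∀ (E E' : Set U) (D : Set (Set (U × U))), D.Nonempty → DirectedOn (· ⊆ ·) D →
    (∀ r ∈ D, r ⊆ E ×ˢ E') → F.map E E' (⋃₀ D) = ⋃ r ∈ D, F.map E E' r

/-- Strictness: `F` maps set inclusions to set inclusions. -/
def StrictFunctor {U : Type*} (F : RelFunctor U) : Prop :=
  ∀ E E' : Set U, E ⊆ E' →
    F.obj E ⊆ F.obj E' ∧ F.map E E' (diagRel E) = diagRel (F.obj E)

theorem diagRel_mono {U : Type*} {E E' : Set U} (h : E ⊆ E') : diagRel E ⊆ diagRel E' :=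
  fun _ hp => ⟨hp.1, h hp.2⟩

theorem diagRel_subset_prod {U : Type*} {E A B : Set U} (hA : E ⊆ A) (hB : E ⊆ B) :
    diagRel E ⊆ A ×ˢ B :=
  fun _ hp => ⟨hA hp.2, hB (hp.1 ▸ hp.2)⟩

theorem relComp_diagRel_self {U : Type*} (E : Set U) :
    relComp (diagRel E) (diagRel E) = diagRel E := by
  ext ⟨a, c⟩
  constructor
  · rintro ⟨b, ⟨hab, ha⟩, hbc, -⟩
    exact ⟨hab.trans hbc, ha⟩
  · rintro ⟨hac, ha⟩
    exact ⟨a, ⟨rfl, ha⟩, hac, ha⟩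

theorem diagRel_sUnion {U : Type*} (𝒟 : Set (Set U)) :
    diagRel (⋃₀ 𝒟) = ⋃₀ (diagRel '' 𝒟) := by
  ext p
  constructor
  · rintro ⟨hp, E, hE, hpE⟩
    exact ⟨diagRel E, ⟨E, hE, rfl⟩, hp, hpE⟩
  · rintro ⟨_, ⟨E, hE, rfl⟩, hp, hpE⟩
    exact ⟨hp, E, hE, hpE⟩

/-- The image of the partial identity on `E ⊆ V` factors through the inclusion of `F.obj E`, so
its range lies in `F.obj E`. -/
theorem StrictFunctor.snd_mem_obj_of_mem_map_diagRel {U : Type*} {F : RelFunctor U}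
    (hs : StrictFunctor F) {E V : Set U} (hE : E ⊆ V) {p : U × U}
    (hp : p ∈ F.map V V (diagRel E)) : p.2 ∈ F.obj E := by
  rw [← relComp_diagRel_self E, F.map_comp V E V _ _ (diagRel_subset_prod hE subset_rfl)
    (diagRel_subset_prod subset_rfl hE), (hs E V hE).2] at hp
  obtain ⟨b, -, hb, hbE⟩ := hp
  exact hb ▸ hbE

/-- A strict locally continuous functor on `Rel` commutes with directed unions
of sets (on objects). -/
theorem strict_locallyContinuous_directed_union {U : Type*} (F : RelFunctor U)
    (hc : LocallyContinuous F) (hs : StrictFunctor F)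
    (𝒟 : Set (Set U)) (hne : 𝒟.Nonempty) (hdir : DirectedOn (· ⊆ ·) 𝒟) :
    F.obj (⋃₀ 𝒟) = ⋃ E ∈ 𝒟, F.obj E := by
  apply subset_antisymm
  · intro x hx
    have hdiag : (x, x) ∈ F.map (⋃₀ 𝒟) (⋃₀ 𝒟) (⋃₀ (diagRel '' 𝒟)) := by
      rw [← diagRel_sUnion, F.map_id]
      exact ⟨rfl, hx⟩
    rw [hc _ _ _ (hne.image _)] at hdiag
    · obtain ⟨_, ⟨E, hE, rfl⟩, hxE⟩ := Set.mem_iUnion₂.1 hdiag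
      exact Set.mem_iUnion₂.2
        ⟨E, hE, hs.snd_mem_obj_of_mem_map_diagRel (Set.subset_sUnion_of_mem hE) hxE⟩
    · rintro _ ⟨A, hA, rfl⟩ _ ⟨B, hB, rfl⟩
      obtain ⟨C, hC, hAC, hBC⟩ := hdir A hA B hB
      exact ⟨_, ⟨C, hC, rfl⟩, diagRel_mono hAC, diagRel_mono hBC⟩
    · rintro _ ⟨E, hE, rfl⟩
      have hsub := Set.subset_sUnion_of_mem hE
      exact diagRel_subset_prod hsub hsub
  · exact Set.iUnion₂_subset fun E hE => (hs E _ (Set.subset_sUnion_of_mem hE)).1
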